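/- arXiv:1512.04710 — 3 statements merged into one kernel-verified Lean document; each statement's English description precedes it below -/
import Mathlib

section
/- Let k be a field and n ≥ 3 an integer. Let Aₙ be the quotient of the free associative unital k-algebra on x₁,…,xₙ by the two-sided ideal generated by the n−2 elements [[x_i, x_{i+2}], x_{i+1}] = x_i x_{i+2} x_{i+1} − x_{i+2} x_i x_{i+1} − x_{i+1} x_i x_{i+2} + x_{i+1} x_{i+2} x_i, for i = 1,…,n−2 (brackets denote ring commutators [a,b] = ab − ba). Then Aₙ has global dimension 2: every left Aₙ-module has projective dimension at most 2, and there exists an Aₙ-module whose projective dimension is exactly 2. -/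
open scoped BigOperators

noncomputable section

universe u

/-- The generator index `i + t` (0-based): for the `i`-th relation (`i = 0,…,n-3`),
the letters involved are `x_i, x_{i+1}, x_{i+2}`. -/
def genIdx (n : ℕ) (i : Fin (n - 2)) (t : Fin 3) : Fin n :=
  ⟨i.val + t.val, by have hi := i.isLt; have ht := t.isLt; omega⟩

/-- The relation `[[x_i, x_{i+2}], x_{i+1}] =
x_i x_{i+2} x_{i+1} − x_{i+2} x_i x_{i+1} − x_{i+1} x_i x_{i+2} + x_{i+1} x_{i+2} x_i`
(written 0-based) in the free associative unital algebra `F = k⟨x_1,…,x_n⟩`. -/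
def lieRel (k : Type) [Field k] (n : ℕ) (i : Fin (n - 2)) : FreeAlgebra k (Fin n) :=
  let X : Fin 3 → FreeAlgebra k (Fin n) := fun t => FreeAlgebra.ι k (genIdx n i t)
  X 0 * X 2 * X 1 - X 2 * X 0 * X 1 - X 1 * X 0 * X 2 + X 1 * X 2 * X 0

/-- The relation identifying each `[[x_i, x_{i+2}], x_{i+1}]` with `0`; quotienting the free
algebra by (the ring congruence generated by) this relation is exactly quotienting by the
two-sided ideal generated by these elements. -/
def lieRelRel (k : Type) [Field k] (n : ℕ) (a b : FreeAlgebra k (Fin n)) : Prop :=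
  b = 0 ∧ ∃ i : Fin (n - 2), a = lieRel k n i

/-- The algebra `Aₙ = k⟨x_1,…,x_n⟩ / ([[x_i, x_{i+2}], x_{i+1}], i = 1,…,n-2)`. -/
abbrev AnAlg (k : Type) [Field k] (n : ℕ) : Type :=
  RingQuot (lieRelRel k n)

/-- The image `x̄_j` of the generator `x_j` in `Aₙ`. -/
def XbarL (k : Type) [Field k] (n : ℕ) (j : Fin n) : AnAlg k n :=
  RingQuot.mkAlgHom k (lieRelRel k n) (FreeAlgebra.ι k j)

/-- The elements `p_{ij}` of the free algebra: `p_{i,i} = x_{i+2} x_{i+1}`,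
`p_{i,i+1} = x_{i+2} x_i − x_i x_{i+2}`, `p_{i,i+2} = −x_i x_{i+1}`, and `p_{ij} = 0`
otherwise, so that `[[x_i, x_{i+2}], x_{i+1}] = Σ_j x_j p_{ij}`. -/
def pLie (k : Type) [Field k] (n : ℕ) (i : Fin (n - 2)) (j : Fin n) :
    FreeAlgebra k (Fin n) :=
  let X : Fin 3 → FreeAlgebra k (Fin n) := fun t => FreeAlgebra.ι k (genIdx n i t)
  if j = genIdx n i 0 then X 2 * X 1
  else if j = genIdx n i 1 then X 2 * X 0 - X 0 * X 2
  else if j = genIdx n i 2 then -(X 0 * X 1)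
  else 0

/-- The image `p̄_{ij}` of `p_{ij}` in `Aₙ`. -/
def PbarL (k : Type) [Field k] (n : ℕ) (i : Fin (n - 2)) (j : Fin n) : AnAlg k n :=
  RingQuot.mkAlgHom k (lieRelRel k n) (pLie k n i j)

/-- The augmentation `ε : Aₙ → k`, the unique `k`-algebra map sending every `x̄_j` to `0`. -/
def augL (k : Type) [Field k] (n : ℕ) : AnAlg k n →ₐ[k] k :=
  RingQuot.liftAlgHom k ⟨FreeAlgebra.lift k (fun _ => (0 : k)), by
    rintro a b ⟨rfl, i, rfl⟩
    simp [lieRel, FreeAlgebra.lift_ι_apply]⟩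

/-- The `A`-module `M` has projective dimension at most 2: there is an exact sequence
`0 → P₂ → P₁ → P₀ → M → 0` with all `Pᵢ` projective. -/
def HasProjDimLE2 (A : Type) [Ring A] (M : Type u) [AddCommGroup M] [Module A M] : Prop :=
  ∃ P₂ P₁ P₀ : ModuleCat.{u} A,
    Module.Projective A P₂ ∧ Module.Projective A P₁ ∧ Module.Projective A P₀ ∧
    ∃ (f₂ : P₂ →ₗ[A] P₁) (f₁ : P₁ →ₗ[A] P₀) (f₀ : P₀ →ₗ[A] M),
      Function.Injective f₂ ∧
      LinearMap.range f₂ = LinearMap.ker f₁ ∧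
      LinearMap.range f₁ = LinearMap.ker f₀ ∧
      Function.Surjective f₀

/-- The `A`-module `M` has projective dimension at most 1: there is an exact sequence
`0 → P₁ → P₀ → M → 0` with `P₀, P₁` projective. -/
def HasProjDimLE1 (A : Type) [Ring A] (M : Type u) [AddCommGroup M] [Module A M] : Prop :=
  ∃ P₁ P₀ : ModuleCat.{u} A,
    Module.Projective A P₁ ∧ Module.Projective A P₀ ∧
    ∃ (f₁ : P₁ →ₗ[A] P₀) (f₀ : P₀ →ₗ[A] M),
      Function.Injective f₁ ∧
      LinearMap.range f₁ = LinearMap.ker f₀ ∧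
      Function.Surjective f₀

/-- `π` presents `A` as the free algebra modulo the two-sided ideal generated by the `ρ i`. -/
structure IsPresentation {k X ι A : Type*} [Field k] [Ring A] [Algebra k A]
    (π : FreeAlgebra k X →ₐ[k] A) (ρ : ι → FreeAlgebra k X) : Prop where
  surjective : Function.Surjective π
  map_rel : ∀ i, π (ρ i) = 0
  ker_le : ∀ a, π a = 0 → a ∈ Submodule.span k {x | ∃ u i v, x = u * ρ i * v}

section Resolution

open TensorProduct

variable {k X ι A M : Type*} [Field k] [Ring A] [Algebra k A]
  [AddCommGroup M] [Module k M]

lemma IsPresentation.tmul_single_induction {Y : Type*}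
    {π : FreeAlgebra k X →ₐ[k] A} {ρ : ι → FreeAlgebra k X} (h : IsPresentation π ρ)
    {p : A ⊗[k] (Y →₀ M) → Prop} (zero : p 0) (add : ∀ y z, p y → p z → p (y + z))
    (tmul_single : ∀ a y m, p (π a ⊗ₜ Finsupp.single y m)) (z : A ⊗[k] (Y →₀ M)) : p z := by
  induction z using TensorProduct.induction_on with
  | zero => exact zero
  | tmul a n =>
    obtain ⟨a, rfl⟩ := h.surjective a
    induction n using Finsupp.induction_linear with
    | zero => rwa [TensorProduct.tmul_zero]
    | add m n hm hn => rw [TensorProduct.tmul_add]; exact add _ _ hm hn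
    | single y m => exact tmul_single a y m
  | add y z hy hz => exact add _ _ hy hz

variable [Module A M] [IsScalarTower k A M]

/-- A linear map on the free algebra vanishing on the ideal of relations descends to `A`. -/
lemma IsPresentation.exists_descent {N : Type*} [AddCommGroup N] [Module k N]
    {π : FreeAlgebra k X →ₐ[k] A} {ρ : ι → FreeAlgebra k X} (h : IsPresentation π ρ)
    (S : FreeAlgebra k X →ₗ[k] N) (hS : ∀ u i v, S (u * ρ i * v) = 0) :
    ∃ T : A →ₗ[k] N, ∀ a, T (π a) = S a := by
  obtain ⟨g, hg⟩ := π.toLinearMap.exists_rightInverse_of_surjective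
    (LinearMap.range_eq_top.2 h.surjective)
  refine ⟨S ∘ₗ g, fun a => ?_⟩
  have hle : Submodule.span k {x | ∃ u i v, x = u * ρ i * v} ≤ LinearMap.ker S := by
    rw [Submodule.span_le]
    rintro _ ⟨u, i, v, rfl⟩
    exact hS u i v
  have hz : π (g (π a) - a) = 0 := by
    have := LinearMap.congr_fun hg (π a)
    simp only [LinearMap.comp_apply, AlgHom.toLinearMap_apply, LinearMap.id_apply] at this
    rw [map_sub, this, sub_self]
  have := hle (h.ker_le _ hz)
  rw [LinearMap.mem_ker, map_sub, sub_eq_zero] at this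
  exact this

/-- Any family `e` of values on the generators extends to a derivation with coefficients in
`Hom k M N`. -/
lemma exists_derivation {N : Type*} [AddCommGroup N] [Module k N] [Module A N]
    [IsScalarTower k A N] (π : FreeAlgebra k X →ₐ[k] A) (e : X → M →ₗ[k] N) :
    ∃ D : FreeAlgebra k X →ₗ[k] M →ₗ[k] N, (∀ x, D (FreeAlgebra.ι k x) = e x) ∧
      ∀ a b m, D (a * b) m = π a • D b m + D a (π b • m) := by
  let lN : A →ₐ[k] Module.End k N := Algebra.lsmul k k N
  let lM : A →ₐ[k] Module.End k M := Algebra.lsmul k k M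
  let Φ : FreeAlgebra k X →ₐ[k] Module.End k (N × M) := FreeAlgebra.lift k fun x =>
    ((lN (π (FreeAlgebra.ι k x))).coprod (e x)).prod
      (lM (π (FreeAlgebra.ι k x)) ∘ₗ LinearMap.snd k N M)
  let D : FreeAlgebra k X →ₗ[k] M →ₗ[k] N :=
    { toFun := fun a => LinearMap.fst k N M ∘ₗ Φ a ∘ₗ LinearMap.inr k N M
      map_add' := fun a b => by ext; simp
      map_smul' := fun c a => by ext; simp }
  have hΦ : ∀ a p m, Φ a (p, m) = (π a • p + D a m, π a • m) := by
    intro a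
    suffices h : ∀ p m, (Φ a (p, m)).1 = π a • p + (Φ a (0, m)).1 ∧ (Φ a (p, m)).2 = π a • m from
      fun p m => Prod.ext (h p m).1 (h p m).2
    induction a using FreeAlgebra.induction with
    | grade0 r => intro p m; simp [algebraMap_smul, Module.algebraMap_end_apply]
    | grade1 x => intro p m; simp [Φ, lN, lM]
    | add a b ha hb =>
      intro p m
      constructor
      · simp only [map_add, LinearMap.add_apply, Prod.fst_add, (ha p m).1, (hb p m).1, add_smul]
        abel
      · simp only [map_add, LinearMap.add_apply, Prod.snd_add, (ha p m).2, (hb p m).2, add_smul]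
    | mul a b ha hb =>
      intro p m
      have h1 : Φ b (p, m) = (π b • p + (Φ b (0, m)).1, π b • m) :=
        Prod.ext (hb p m).1 (hb p m).2
      have h2 : (Φ a (Φ b (0, m))).1 = π a • (Φ b (0, m)).1 + (Φ a (0, π b • m)).1 :=
        (congrArg (fun q => (Φ a q).1) (Prod.ext rfl (hb 0 m).2 :
          Φ b (0, m) = ((Φ b (0, m)).1, π b • m))).trans (ha _ _).1
      constructor
      · rw [map_mul, Module.End.mul_apply, Module.End.mul_apply, h1, (ha _ _).1, h2,
          map_mul, mul_smul, smul_add, add_assoc]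
      · rw [map_mul, Module.End.mul_apply, h1, (ha _ _).2, map_mul, mul_smul]
  refine ⟨D, fun x => ?_, fun a b m => ?_⟩
  · ext m
    simp [D, Φ]
  · have : D (a * b) m = (Φ a (Φ b (0, m))).1 := by simp [D]
    rw [this, hΦ, hΦ]
    simp

variable (A) in
/-- A `k`-linear map into an `A`-module extends to an `A`-linear map on the induced module. -/
lemma exists_baseChange_lift {N P : Type*} [AddCommGroup N] [Module k N] [AddCommGroup P]
    [Module k P] [Module A P] [IsScalarTower k A P] (φ : N →ₗ[k] P) :
    ∃ f : A ⊗[k] N →ₗ[A] P, ∀ a n, f (a ⊗ₜ n) = a • φ n :=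
  ⟨TensorProduct.AlgebraTensorModule.lift
    { toFun := fun a => (Algebra.lsmul k k P a : P →ₗ[k] P) ∘ₗ φ
      map_add' := fun a b => by ext; simp
      map_smul' := fun a b => by ext; simp }, fun a n => by simp⟩

/-- A linear map on the free algebra that is right linear on the ideal of relations induces a
map on `A ⊗ (X →₀ M)` measuring its failure to be right linear. -/
lemma IsPresentation.exists_map_of_right_linear {P : Type*} [AddCommGroup P] [Module k P]
    {π : FreeAlgebra k X →ₐ[k] A} {ρ : ι → FreeAlgebra k X} (h : IsPresentation π ρ)
    (Θ : FreeAlgebra k X →ₗ[k] M →ₗ[k] P)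
    (hΘ : ∀ u i v c m, Θ (u * ρ i * v * c) m = Θ (u * ρ i * v) (π c • m)) :
    ∃ s : A ⊗[k] (X →₀ M) →ₗ[k] P, ∀ a x m, s (π a ⊗ₜ Finsupp.single x m) =
      Θ (a * FreeAlgebra.ι k x) m - Θ a (π (FreeAlgebra.ι k x) • m) := by
  choose T hT using fun x : X => h.exists_descent (N := M →ₗ[k] P)
    (Θ ∘ₗ LinearMap.mulRight k (FreeAlgebra.ι k x) -
      (LinearMap.lcomp k P
        (Algebra.lsmul k k M (π (FreeAlgebra.ι k x)) : M →ₗ[k] M)) ∘ₗ Θ) (by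
      intro u i v
      ext m
      simp [hΘ])
  refine ⟨TensorProduct.lift (LinearMap.flip (Finsupp.lsum k fun x => (T x).flip)),
    fun a x m => ?_⟩
  simp [hT]

lemma IsPresentation.exists_resolution
    {π : FreeAlgebra k X →ₐ[k] A} {ρ : ι → FreeAlgebra k X} (h : IsPresentation π ρ)
    (hΘ : ∃ Θ : FreeAlgebra k X →ₗ[k] M →ₗ[k] A ⊗[k] (ι →₀ M),
      ∀ u i v m, Θ (u * ρ i * v) m = π u ⊗ₜ Finsupp.single i (π v • m)) :
    ∃ (D : FreeAlgebra k X →ₗ[k] M →ₗ[k] A ⊗[k] (X →₀ M))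
      (f₂ : A ⊗[k] (ι →₀ M) →ₗ[A] A ⊗[k] (X →₀ M)) (f₁ : A ⊗[k] (X →₀ M) →ₗ[A] A ⊗[k] M)
      (f₀ : A ⊗[k] M →ₗ[A] M),
      (∀ a b m, D (a * b) m = π a • D b m + D a (π b • m)) ∧
      (∀ i m, f₂ (1 ⊗ₜ Finsupp.single i m) = D (ρ i) m) ∧
      Function.Injective f₂ ∧ LinearMap.range f₂ = LinearMap.ker f₁ ∧
      LinearMap.range f₁ = LinearMap.ker f₀ ∧ Function.Surjective f₀ := by
  classical
  obtain ⟨Θ, hΘ⟩ := hΘ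
  let e : X → M →ₗ[k] A ⊗[k] (X →₀ M) := fun x =>
    TensorProduct.mk k A (X →₀ M) 1 ∘ₗ Finsupp.lsingle x
  have he : ∀ x m, e x m = 1 ⊗ₜ Finsupp.single x m := fun x m => rfl
  obtain ⟨D, hDι, hD⟩ := exists_derivation (A := A) π e
  have hDr : ∀ r m, D (algebraMap k _ r) m = 0 := by
    intro r m
    have h1 := hD 1 1 m
    rw [mul_one, map_one π, one_smul, one_smul, left_eq_add] at h1
    rw [Algebra.algebraMap_eq_smul_one, map_smul, LinearMap.smul_apply, h1, smul_zero]
  obtain ⟨f₂, hf₂⟩ := exists_baseChange_lift A (Finsupp.lsum k fun i => D (ρ i))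
  obtain ⟨f₁, hf₁⟩ := exists_baseChange_lift A (Finsupp.lsum k fun x =>
    TensorProduct.mk k A M (π (FreeAlgebra.ι k x)) -
      TensorProduct.mk k A M 1 ∘ₗ (Algebra.lsmul k k M (π (FreeAlgebra.ι k x)) : M →ₗ[k] M))
  obtain ⟨f₀, hf₀⟩ := exists_baseChange_lift A (LinearMap.id : M →ₗ[k] M)
  have hf₂' : ∀ a i m, f₂ (a ⊗ₜ Finsupp.single i m) = a • D (ρ i) m := by
    intro a i m; simp [hf₂]
  have hf₁' : ∀ a x m, f₁ (a ⊗ₜ Finsupp.single x m) =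
      (a * π (FreeAlgebra.ι k x)) ⊗ₜ m - a ⊗ₜ (π (FreeAlgebra.ι k x) • m) := by
    intro a x m; simp [hf₁, smul_sub, TensorProduct.smul_tmul']
  have hf₁D : ∀ a m, f₁ (D a m) = π a ⊗ₜ m - 1 ⊗ₜ (π a • m) := by
    intro a
    induction a using FreeAlgebra.induction with
    | grade0 r =>
      intro m
      rw [hDr, map_zero, AlgHom.commutes, algebraMap_smul, Algebra.algebraMap_eq_smul_one,
        TensorProduct.smul_tmul, sub_self]
    | grade1 x => intro m; rw [hDι, he, hf₁', one_mul]
    | add a b ha hb =>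
      intro m
      simp only [map_add, LinearMap.add_apply, ha, hb, add_smul, TensorProduct.add_tmul,
        TensorProduct.tmul_add]
      abel
    | mul a b ha hb =>
      intro m
      rw [hD, map_add, map_smul, ha, hb, smul_sub, TensorProduct.smul_tmul',
        TensorProduct.smul_tmul', map_mul, smul_eq_mul, smul_eq_mul, mul_one, mul_smul]
      abel
  refine ⟨D, f₂, f₁, f₀, hD, fun i m => by rw [hf₂', one_smul], ?_, ?_, ?_, ?_⟩
  · obtain ⟨s, hs⟩ := h.exists_map_of_right_linear Θ fun u i v c m => by
      rw [hΘ, mul_assoc, hΘ, map_mul, mul_smul]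
    have hsD : ∀ b a m, s (π a • D b m) = Θ (a * b) m - Θ a (π b • m) := by
      intro b
      induction b using FreeAlgebra.induction with
      | grade0 r =>
        intro a m
        rw [hDr, smul_zero, map_zero, AlgHom.commutes, algebraMap_smul, map_smul,
          Algebra.algebraMap_eq_smul_one, mul_smul_comm, mul_one, map_smul,
          LinearMap.smul_apply, sub_self]
      | grade1 x =>
        intro a m
        rw [hDι, he, TensorProduct.smul_tmul', smul_eq_mul, mul_one, hs]
      | add b c hb hc =>
        intro a m
        simp only [map_add, LinearMap.add_apply, smul_add, hb, hc, mul_add, add_smul]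
        abel
      | mul b c hb hc =>
        intro a m
        rw [hD, smul_add, ← mul_smul, ← map_mul π, map_add, hc, hb, mul_assoc, map_mul π, mul_smul]
        abel
    have hsf : ∀ z, s (f₂ z) = z := by
      refine h.tmul_single_induction (by simp)
        (fun a b ha hb => by rw [map_add, map_add, ha, hb])
        fun a i m => ?_
      rw [hf₂', hsD, h.map_rel, zero_smul, map_zero, sub_zero]
      simpa using hΘ a i 1 m
    exact Function.LeftInverse.injective hsf
  · apply le_antisymm
    · rintro _ ⟨z, rfl⟩
      rw [LinearMap.mem_ker]
      revert z
      refine h.tmul_single_induction (by simp)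
        (fun a b ha hb => by rw [map_add, map_add, ha, hb, add_zero])
        fun a i m => ?_
      rw [hf₂', map_smul, hf₁D, h.map_rel]
      simp
    · let q := (LinearMap.range f₂).mkQ
      obtain ⟨T, hT⟩ := h.exists_descent
        ((LinearMap.llcomp k M _ _ (q.restrictScalars k)) ∘ₗ D) (by
          intro u i v
          ext m
          have : u * ρ i * v = u * (ρ i * v) := mul_assoc _ _ _
          simp only [LinearMap.comp_apply, LinearMap.llcomp_apply, this, hD, map_mul, h.map_rel,
            zero_mul, zero_smul, map_zero, add_zero, zero_add, LinearMap.zero_apply]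
          refine (Submodule.Quotient.mk_eq_zero _).2 ⟨π u ⊗ₜ Finsupp.single i (π v • m), ?_⟩
          rw [hf₂'])
      let t : A ⊗[k] M →ₗ[k] _ := TensorProduct.lift T
      have ht : ∀ z, t (f₁ z) = q z := by
        refine h.tmul_single_induction (by simp)
          (fun a b ha hb => by rw [map_add, map_add, ha, hb, map_add])
          fun a x m => ?_
        rw [hf₁', ← map_mul]
        have hx := hD a (FreeAlgebra.ι k x) m
        rw [hDι, he, TensorProduct.smul_tmul', smul_eq_mul, mul_one, ← sub_eq_iff_eq_add] at hx
        rw [← hx]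
        simp only [t, map_sub, TensorProduct.lift.tmul, hT]
        rfl
      intro z hz
      have := ht z
      rw [LinearMap.mem_ker.1 hz, map_zero] at this
      exact (Submodule.Quotient.mk_eq_zero _).1 this.symm
  · apply le_antisymm
    · rintro _ ⟨z, rfl⟩
      rw [LinearMap.mem_ker]
      revert z
      refine h.tmul_single_induction (by simp)
        (fun a b ha hb => by rw [map_add, map_add, ha, hb, add_zero])
        fun a i m => ?_
      rw [hf₁', map_sub, hf₀, hf₀, LinearMap.id_apply, LinearMap.id_apply, mul_smul, sub_self]
    · have hz : ∀ z, z - 1 ⊗ₜ f₀ z ∈ LinearMap.range f₁ := by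
        intro z
        induction z using TensorProduct.induction_on with
        | zero => simp
        | tmul a m =>
          obtain ⟨a, rfl⟩ := h.surjective a
          exact ⟨D a m, by rw [hf₁D, hf₀, LinearMap.id_apply]⟩
        | add y z hy hz =>
          rw [map_add, TensorProduct.tmul_add, add_sub_add_comm]
          exact Submodule.add_mem _ hy hz
      intro z h0
      simpa [LinearMap.mem_ker.1 h0] using hz z
  · exact fun m => ⟨1 ⊗ₜ m, by simp [hf₀]⟩

end Resolution

section Rewriting

variable {k X ι J Q : Type*} [Field k] [Fintype J] [AddCommGroup Q] [Module k Q]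

variable (k) in
/-- The monomial of the free algebra spelled by a word. -/
def monomialOf (w : List X) : FreeAlgebra k X := (w.map (FreeAlgebra.ι k)).prod

lemma monomialOf_append (u v : List X) :
    monomialOf k (u ++ v) = monomialOf k u * monomialOf k v := by
  simp [monomialOf]

lemma basisFreeMonoid_ofList (w : List X) :
    FreeAlgebra.basisFreeMonoid k X (FreeMonoid.ofList w) = monomialOf k w := by
  simp [FreeAlgebra.basisFreeMonoid, FreeAlgebra.equivMonoidAlgebraFreeMonoid, monomialOf,
    FreeMonoid.lift_apply]

/-- The rewriting rules `W i → ∑ j, c i j • H i j` decrease `val` in every context, and any two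
occurrences of leading words in the same word are equal or disjoint. -/
structure IsNonoverlapping (W : ι → List X) (H : ι → J → List X) (val : List X → ℕ) : Prop where
  val_lt : ∀ i j u v, val (u ++ H i j ++ v) < val (u ++ W i ++ v)
  disjoint : ∀ u i v u' l v', u ++ W i ++ v = u' ++ W l ++ v' →
    (u = u' ∧ i = l ∧ v = v') ∨ (∃ s, u = u' ++ W l ++ s ∧ v' = s ++ W i ++ v) ∨
      (∃ s, u' = u ++ W i ++ s ∧ v = s ++ W l ++ v')

variable {W : ι → List X} {H : ι → J → List X} {val : List X → ℕ}

/-- Recursion along the rewriting rules, choosing one occurrence of a leading word in each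
reducible word. -/
lemma IsNonoverlapping.exists_reduction (hW : IsNonoverlapping W H val) (c : ι → J → k)
    (t : List X → ι → List X → Q) :
    ∃ θ : List X → Q, ∀ u i v, ∃ u' i' v', u ++ W i ++ v = u' ++ W i' ++ v' ∧
      θ (u ++ W i ++ v) = t u' i' v' + ∑ j, c i' j • θ (u' ++ H i' j ++ v') := by
  classical
  let P : List X → List X × ι × List X → Prop := fun w p => w = p.1 ++ W p.2.1 ++ p.2.2
  let wf := (measure val).wf
  let step : ∀ w, (∀ w', val w' < val w → Q) → Q := fun w rec =>
    if h : ∃ p, P w p then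
      t h.choose.1 h.choose.2.1 h.choose.2.2 + ∑ j, c h.choose.2.1 j •
        rec (h.choose.1 ++ H h.choose.2.1 j ++ h.choose.2.2) (by
          conv_rhs => rw [h.choose_spec]
          exact hW.val_lt _ _ _ _)
    else 0
  refine ⟨wf.fix step, fun u i v => ?_⟩
  have h : ∃ p, P (u ++ W i ++ v) p := ⟨(u, i, v), rfl⟩
  refine ⟨h.choose.1, h.choose.2.1, h.choose.2.2, h.choose_spec, ?_⟩
  rw [wf.fix_eq]
  exact dif_pos h

/-- If the leading words of the relations `ρ i` do not overlap, then any bilinear data `τ` that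
vanishes on the ideal of relations in both arguments comes from a linear map on the ideal. -/
lemma IsNonoverlapping.exists_linearMap (hW : IsNonoverlapping W H val) {c : ι → J → k}
    {ρ : ι → FreeAlgebra k X}
    (hρ : ∀ i, ρ i = monomialOf k (W i) - ∑ j, c i j • monomialOf k (H i j))
    (τ : ι → FreeAlgebra k X →ₗ[k] FreeAlgebra k X →ₗ[k] Q)
    (hleft : ∀ i u l v b, τ i (u * ρ l * v) b = 0)
    (hright : ∀ i a u l v, τ i a (u * ρ l * v) = 0) :
    ∃ Θ : FreeAlgebra k X →ₗ[k] Q, ∀ u i v, Θ (u * ρ i * v) = τ i u v := by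
  obtain ⟨θ, hθ⟩ := hW.exists_reduction c
    fun u i v => τ i (monomialOf k u) (monomialOf k v)
  let Θ : FreeAlgebra k X →ₗ[k] Q :=
    (FreeAlgebra.basisFreeMonoid k X).constr k fun w => θ (FreeMonoid.toList w)
  have hΘ : ∀ w, Θ (monomialOf k w) = θ w := by
    intro w
    rw [← basisFreeMonoid_ofList, Module.Basis.constr_basis]
    rfl
  have hexp : ∀ u i v, monomialOf k u * ρ i * monomialOf k v =
      monomialOf k (u ++ W i ++ v) - ∑ j, c i j • monomialOf k (u ++ H i j ++ v) := by
    intro u i v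
    simp only [hρ, monomialOf_append, mul_sub, sub_mul, Finset.mul_sum, Finset.sum_mul,
      mul_smul_comm, smul_mul_assoc]
  have hmon : ∀ N u i v, val (u ++ W i ++ v) = N →
      Θ (monomialOf k u * ρ i * monomialOf k v) = τ i (monomialOf k u) (monomialOf k v) := by
    intro N
    induction N using Nat.strong_induction_on with
    | _ N ih =>
    rintro u i v rfl
    obtain ⟨u', l, v', huv, hval⟩ := hθ u i v
    have hchosen : Θ (monomialOf k u' * ρ l * monomialOf k v') =
        τ l (monomialOf k u') (monomialOf k v') := by
      rw [hexp, map_sub, hΘ, ← huv, hval, map_sum]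
      simp only [map_smul, hΘ, add_sub_cancel_right]
    have hWρ : ∀ i, monomialOf k (W i) = ρ i + ∑ j, c i j • monomialOf k (H i j) := by
      intro i; rw [hρ, sub_add_cancel]
    rcases hW.disjoint _ _ _ _ _ _ huv with ⟨rfl, rfl, rfl⟩ | ⟨s, rfl, rfl⟩ | ⟨s, rfl, rfl⟩
    · exact hchosen
    · have h1 : ∀ j, Θ (monomialOf k (u' ++ H l j ++ s) * ρ i * monomialOf k v) =
          τ i (monomialOf k (u' ++ H l j ++ s)) (monomialOf k v) := fun j =>
        ih _ (by simpa using hW.val_lt l j u' (s ++ W i ++ v)) _ _ _ rfl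
      have h2 : ∀ j, Θ (monomialOf k u' * ρ l * monomialOf k (s ++ H i j ++ v)) =
          τ l (monomialOf k u') (monomialOf k (s ++ H i j ++ v)) := fun j =>
        ih _ (by simpa using hW.val_lt i j (u' ++ W l ++ s) v) _ _ _ (by simp)
      have hl := hleft i (monomialOf k u') l (monomialOf k s) (monomialOf k v)
      have hr := hright l (monomialOf k u') (monomialOf k s) i (monomialOf k v)
      have e : monomialOf k (u' ++ W l ++ s) * ρ i * monomialOf k v =
          monomialOf k u' * ρ l * monomialOf k (s ++ W i ++ v) -
          ∑ j, c i j • (monomialOf k u' * ρ l * monomialOf k (s ++ H i j ++ v)) +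
          ∑ j, c l j • (monomialOf k (u' ++ H l j ++ s) * ρ i * monomialOf k v) := by
        simp only [monomialOf_append, hWρ, mul_add, add_mul, Finset.mul_sum, Finset.sum_mul,
          mul_smul_comm, smul_mul_assoc, mul_assoc]
        abel
      rw [hexp] at hl hr
      rw [e, map_add, map_sub, hchosen, map_sum, map_sum]
      simp only [map_smul, h1, h2]
      simp only [map_sub, map_sum, map_smul, LinearMap.sub_apply, LinearMap.sum_apply,
        LinearMap.smul_apply, sub_eq_zero] at hl hr
      rw [hl, hr, sub_self, zero_add]
    · have h1 : ∀ j, Θ (monomialOf k u * ρ i * monomialOf k (s ++ H l j ++ v')) =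
          τ i (monomialOf k u) (monomialOf k (s ++ H l j ++ v')) := fun j =>
        ih _ (by simpa using hW.val_lt l j (u ++ W i ++ s) v') _ _ _ (by simp)
      have h2 : ∀ j, Θ (monomialOf k (u ++ H i j ++ s) * ρ l * monomialOf k v') =
          τ l (monomialOf k (u ++ H i j ++ s)) (monomialOf k v') := fun j =>
        ih _ (by simpa using hW.val_lt i j u (s ++ W l ++ v')) _ _ _ (by simp)
      have hl := hleft l (monomialOf k u) i (monomialOf k s) (monomialOf k v')
      have hr := hright i (monomialOf k u) (monomialOf k s) l (monomialOf k v')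
      have e : monomialOf k u * ρ i * monomialOf k (s ++ W l ++ v') =
          monomialOf k (u ++ W i ++ s) * ρ l * monomialOf k v' -
          ∑ j, c i j • (monomialOf k (u ++ H i j ++ s) * ρ l * monomialOf k v') +
          ∑ j, c l j • (monomialOf k u * ρ i * monomialOf k (s ++ H l j ++ v')) := by
        simp only [monomialOf_append, hWρ, mul_add, add_mul, Finset.mul_sum, Finset.sum_mul,
          mul_smul_comm, smul_mul_assoc, mul_assoc]
        abel
      rw [hexp] at hl hr
      rw [e, map_add, map_sub, hchosen, map_sum, map_sum]
      simp only [map_smul, h1, h2]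
      simp only [map_sub, map_sum, map_smul, LinearMap.sub_apply, LinearMap.sum_apply,
        LinearMap.smul_apply, sub_eq_zero] at hl hr
      rw [hl, hr, sub_self, zero_add]
  have hspan : ∀ p : FreeAlgebra k X → Prop, (∀ w, p (monomialOf k w)) →
      (∀ a b, p a → p b → p (a + b)) → (∀ (r : k) a, p a → p (r • a)) → p 0 → ∀ a, p a := by
    intro p hp hadd hsmul hzero a
    have ha := (FreeAlgebra.basisFreeMonoid k X).mem_span a
    induction ha using Submodule.span_induction with
    | mem x hx =>
      obtain ⟨w, rfl⟩ := hx
      exact basisFreeMonoid_ofList (k := k) (FreeMonoid.toList w) ▸ hp _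
    | zero => exact hzero
    | add a b _ _ ha hb => exact hadd a b ha hb
    | smul r a _ ha => exact hsmul r a ha
  refine ⟨Θ, fun u i v => ?_⟩
  revert u
  refine hspan _ (fun u => ?_) (fun a b ha hb => ?_) (fun r a ha => ?_) (by simp)
  · revert v
    refine hspan _ (fun v => hmon _ u i v rfl) (fun a b ha hb => ?_) (fun r a ha => ?_) (by simp)
    · rw [mul_add, map_add, map_add, ha, hb]
    · rw [mul_smul_comm, map_smul, map_smul, ha]
  · rw [add_mul, add_mul, map_add, map_add, LinearMap.add_apply, ha, hb]
  · rw [smul_mul_assoc, smul_mul_assoc, map_smul, map_smul, LinearMap.smul_apply, ha]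

end Rewriting

section RewritingResolution

open TensorProduct

variable {k X ι A M J : Type*} [Field k] [Ring A] [Algebra k A] [Fintype J]
  [AddCommGroup M] [Module k M] [Module A M] [IsScalarTower k A M]

variable (M) in
lemma IsNonoverlapping.exists_bimodule_map {W : ι → List X} {H : ι → J → List X}
    {val : List X → ℕ} (hW : IsNonoverlapping W H val) {c : ι → J → k}
    {π : FreeAlgebra k X →ₐ[k] A} {ρ : ι → FreeAlgebra k X} (h : IsPresentation π ρ)
    (hρ : ∀ i, ρ i = monomialOf k (W i) - ∑ j, c i j • monomialOf k (H i j)) :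
    ∃ Θ : FreeAlgebra k X →ₗ[k] M →ₗ[k] A ⊗[k] (ι →₀ M),
      ∀ u i v m, Θ (u * ρ i * v) m = π u ⊗ₜ Finsupp.single i (π v • m) := by
  let B : ι → A →ₗ[k] A →ₗ[k] M →ₗ[k] A ⊗[k] (ι →₀ M) := fun i =>
    { toFun := fun a =>
        { toFun := fun b => TensorProduct.mk k A (ι →₀ M) a ∘ₗ Finsupp.lsingle i ∘ₗ
            (Algebra.lsmul k k M b : M →ₗ[k] M)
          map_add' := fun b b' => by ext; simp [tmul_add]
          map_smul' := fun r b => by ext; simp [← Finsupp.smul_single] }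
      map_add' := fun a a' => by ext; simp
      map_smul' := fun r a => by ext; simp [smul_tmul'] }
  have hB : ∀ i a b m, B i a b m = a ⊗ₜ Finsupp.single i (b • m) := fun i a b m => rfl
  obtain ⟨Θ, hΘ⟩ := hW.exists_linearMap (Q := M →ₗ[k] A ⊗[k] (ι →₀ M)) hρ
    (fun i => (B i).compl₁₂ π.toLinearMap π.toLinearMap)
    (by intros; simp [h.map_rel]) (by intros; simp [h.map_rel])
  exact ⟨Θ, fun u i v m => (LinearMap.congr_fun (hΘ u i v) m).trans (hB i _ _ m)⟩

end RewritingResolution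

section ProjectiveDimension

/-- A linear map out of a projective module lifts along any map whose range contains its range. -/
lemma exists_lift_of_range_le {R P N L : Type*} [Ring R] [AddCommGroup P] [Module R P]
    [AddCommGroup N] [Module R N] [AddCommGroup L] [Module R L] [Module.Projective R P]
    (f : P →ₗ[R] N) (g : L →ₗ[R] N) (hfg : LinearMap.range f ≤ LinearMap.range g) :
    ∃ h : P →ₗ[R] L, ∀ x, g (h x) = f x := by
  obtain ⟨h, hh⟩ := Module.projective_lifting_property g.rangeRestrict
    (f.codRestrict (LinearMap.range g) fun x => hfg ⟨x, rfl⟩) g.surjective_rangeRestrict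
  exact ⟨h, fun x => congrArg Subtype.val (LinearMap.congr_fun hh x)⟩

/-- If `M` has projective dimension at most one, then the last map of any projective resolution
of `M` of length two is a split injection. -/
lemma HasProjDimLE1.exists_retraction {A : Type} [Ring A] {M : Type u} [AddCommGroup M]
    [Module A M] (hM : HasProjDimLE1 A M) {P₂ P₁ P₀ : Type*} [AddCommGroup P₂] [Module A P₂]
    [AddCommGroup P₁] [Module A P₁] [AddCommGroup P₀] [Module A P₀]
    [Module.Projective A P₁] [Module.Projective A P₀]
    {f₂ : P₂ →ₗ[A] P₁} {f₁ : P₁ →ₗ[A] P₀} {f₀ : P₀ →ₗ[A] M}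
    (inj : Function.Injective f₂) (ex₁ : LinearMap.range f₂ = LinearMap.ker f₁)
    (ex₀ : LinearMap.range f₁ = LinearMap.ker f₀) (surj : Function.Surjective f₀) :
    ∃ r : P₁ →ₗ[A] P₂, ∀ x, r (f₂ x) = x := by
  obtain ⟨Q₁, Q₀, _, _, g₁, g₀, ginj, gex, gsurj⟩ := hM
  have hf12 : ∀ x, f₁ (f₂ x) = 0 := fun x => by
    have : f₂ x ∈ LinearMap.ker f₁ := ex₁ ▸ ⟨x, rfl⟩
    exact this
  have hf01 : ∀ x, f₀ (f₁ x) = 0 := fun x => by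
    have : f₁ x ∈ LinearMap.ker f₀ := ex₀ ▸ ⟨x, rfl⟩
    exact this
  have hg01 : ∀ x, g₀ (g₁ x) = 0 := fun x => by
    have : g₁ x ∈ LinearMap.ker g₀ := gex ▸ ⟨x, rfl⟩
    exact this
  obtain ⟨α₀, hα₀⟩ := exists_lift_of_range_le f₀ g₀
    (by rw [LinearMap.range_eq_top.2 gsurj]; exact le_top)
  obtain ⟨β₀, hβ₀⟩ := exists_lift_of_range_le g₀ f₀
    (by rw [LinearMap.range_eq_top.2 surj]; exact le_top)
  obtain ⟨α₁, hα₁⟩ := exists_lift_of_range_le (α₀ ∘ₗ f₁) g₁ (by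
    rw [gex]; rintro _ ⟨x, rfl⟩; simp [hα₀, hf01])
  obtain ⟨β₁, hβ₁⟩ := exists_lift_of_range_le (β₀ ∘ₗ g₁) f₁ (by
    rw [ex₀]; rintro _ ⟨x, rfl⟩; simp [hβ₀, hg01])
  obtain ⟨h₀, hh₀⟩ := exists_lift_of_range_le (LinearMap.id - β₀ ∘ₗ α₀) f₁ (by
    rw [ex₀]; rintro _ ⟨x, rfl⟩; simp [hβ₀, hα₀])
  obtain ⟨r, hr⟩ := exists_lift_of_range_le (LinearMap.id - β₁ ∘ₗ α₁ - h₀ ∘ₗ f₁) f₂ (by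
    rw [ex₁]; rintro _ ⟨x, rfl⟩; simp [hβ₁, hα₁, hh₀])
  refine ⟨r, fun x => inj ?_⟩
  have hα : α₁ (f₂ x) = 0 := ginj (by simp [hα₁, hf12])
  simp [hr, hα, hf12]

end ProjectiveDimension

section Presentation

variable {k X ι : Type*} [Field k]

/-- Quotienting the free algebra by the relations `f i = 0` presents the quotient. -/
lemma isPresentation_mkAlgHom {rel : FreeAlgebra k X → FreeAlgebra k X → Prop}
    {ρ : ι → FreeAlgebra k X} (hrel : ∀ a b, rel a b ↔ b = 0 ∧ ∃ i, a = -ρ i) :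
    IsPresentation (RingQuot.mkAlgHom k rel) ρ where
  surjective := RingQuot.mkAlgHom_surjective k rel
  map_rel i := by
    have := RingQuot.mkAlgHom_rel k ((hrel (-ρ i) 0).2 ⟨rfl, i, rfl⟩)
    rwa [map_neg, map_zero, neg_eq_zero] at this
  ker_le a ha := by
    set I := Submodule.span k {x | ∃ u i v, x = u * ρ i * v}
    have hmul : ∀ x ∈ I, ∀ u v, u * x * v ∈ I := by
      intro x hx u v
      induction hx using Submodule.span_induction with
      | mem x hx =>
        obtain ⟨u', i, v', rfl⟩ := hx
        exact Submodule.subset_span ⟨u * u', i, v' * v, by simp only [mul_assoc]⟩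
      | zero => simp
      | add x y _ _ hx hy => rw [mul_add, add_mul]; exact I.add_mem hx hy
      | smul r x _ hx => rw [mul_smul_comm, smul_mul_assoc]; exact I.smul_mem r hx
    have hRel : ∀ a b, RingQuot.Rel rel a b → a - b ∈ I := by
      intro a b hab
      induction hab with
      | of h =>
        obtain ⟨rfl, i, rfl⟩ := (hrel _ _).1 h
        rw [sub_zero]
        exact I.neg_mem (Submodule.subset_span ⟨1, i, 1, by simp⟩)
      | add_left _ ih => rwa [add_sub_add_right_eq_sub]
      | mul_left _ ih => rw [← sub_mul]; simpa using hmul _ ih 1 _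
      | mul_right _ ih => rw [← mul_sub]; simpa using hmul _ ih _ 1
    have hgen : ∀ a b, Relation.EqvGen (RingQuot.Rel rel) a b → a - b ∈ I := by
      intro a b hab
      induction hab with
      | rel _ _ h => exact hRel _ _ h
      | refl => simp
      | symm _ _ _ h => simpa using I.neg_mem h
      | trans _ _ _ _ _ h h' => simpa using I.add_mem h h'
    have h0 : RingQuot.mkRingHom rel a = RingQuot.mkRingHom rel 0 := by
      rw [map_zero, ← RingQuot.mkAlgHom_coe k]
      exact ha
    simp only [RingQuot.mkRingHom_def] at h0
    simpa using hgen a 0 (Quot.eqvGen_exact (congrArg RingQuot.toQuot h0))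

end Presentation

section LieRelations

/-- Priority of a letter: even indices come above odd ones, increasing on even indices and
decreasing on odd ones. -/
def letterRank (n : ℕ) (x : Fin n) : ℕ :=
  if x.val % 2 = 0 then n + x.val else n - x.val

/-- The binary expansion with letter ranks as digits. -/
def wordWeight (n : ℕ) : List (Fin n) → ℕ
  | [] => 0
  | x :: w => letterRank n x * 2 ^ w.length + wordWeight n w

lemma wordWeight_append (n : ℕ) (u w : List (Fin n)) :
    wordWeight n (u ++ w) = wordWeight n u * 2 ^ w.length + wordWeight n w := by
  induction u with
  | nil => simp [wordWeight]
  | cons x u ih =>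
    simp only [List.cons_append, wordWeight, ih, List.length_append, pow_add]
    ring

lemma wordWeight_lt {n : ℕ} {h w : List (Fin n)} (hl : h.length = w.length)
    (hlt : wordWeight n h < wordWeight n w) (u v : List (Fin n)) :
    wordWeight n (u ++ h ++ v) < wordWeight n (u ++ w ++ v) := by
  simp only [wordWeight_append, hl]
  have : 0 < 2 ^ v.length := by positivity
  gcongr

/-- The leading word of the `i`-th relation. -/
def leadingWord (n : ℕ) (i : Fin (n - 2)) : List (Fin n) :=
  if i.val % 2 = 0 then [genIdx n i 2, genIdx n i 0, genIdx n i 1]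
  else [genIdx n i 1, genIdx n i 0, genIdx n i 2]

/-- The remaining words of the `i`-th relation. -/
def lowerWord (n : ℕ) (i : Fin (n - 2)) : Fin 3 → List (Fin n) :=
  ![[genIdx n i 0, genIdx n i 2, genIdx n i 1],
    if i.val % 2 = 0 then [genIdx n i 1, genIdx n i 0, genIdx n i 2]
      else [genIdx n i 2, genIdx n i 0, genIdx n i 1],
    [genIdx n i 1, genIdx n i 2, genIdx n i 0]]

lemma neg_lieRel_eq (k : Type) [Field k] (n : ℕ) (i : Fin (n - 2)) :
    -lieRel k n i = monomialOf k (leadingWord n i) -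
      ∑ j, (![1, -1, 1] : Fin 3 → k) j • monomialOf k (lowerWord n i j) := by
  rw [Fin.sum_univ_three]
  by_cases hi : i.val % 2 = 0
  · simp [lieRel, leadingWord, lowerWord, hi, monomialOf, mul_assoc]
    abel
  · simp [lieRel, leadingWord, lowerWord, hi, monomialOf, mul_assoc]
    abel

/-- Words of length three that overlap neither in one nor in two letters. -/
lemma occurrence_of_append_eq {X ι : Type*} {a b c : ι → X} (h₁ : ∀ i l, c i ≠ a l)
    (h₂ : ∀ i l, b i = a l → c i ≠ b l)
    (h₃ : ∀ i l, a i = a l → b i = b l → c i = c l → i = l)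
    {i l : ι} {v t v' : List X}
    (h : [a i, b i, c i] ++ v = t ++ ([a l, b l, c l] ++ v')) :
    (t = [] ∧ i = l ∧ v = v') ∨
      ∃ s, t = [a i, b i, c i] ++ s ∧ v = s ++ ([a l, b l, c l] ++ v') := by
  rcases t with _ | ⟨x, _ | ⟨y, _ | ⟨z, s⟩⟩⟩
  · simp only [List.cons_append, List.nil_append, List.cons.injEq] at h
    exact .inl ⟨rfl, h₃ i l h.1 h.2.1 h.2.2.1, h.2.2.2⟩
  · simp only [List.cons_append, List.nil_append, List.cons.injEq] at h
    exact absurd h.2.2.1 (h₂ i l h.2.1)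
  · simp only [List.cons_append, List.nil_append, List.cons.injEq] at h
    exact absurd h.2.2.1 (h₁ i l)
  · simp only [List.cons_append, List.nil_append, List.cons.injEq] at h
    obtain ⟨rfl, rfl, rfl, rfl⟩ := h
    exact .inr ⟨s, by simp⟩

lemma isNonoverlapping_leadingWord (n : ℕ) :
    IsNonoverlapping (leadingWord n) (lowerWord n) (wordWeight n) where
  val_lt i j u v := by
    have hi := i.isLt
    have hlen : (lowerWord n i j).length = (leadingWord n i).length := by
      fin_cases j <;> simp [lowerWord, leadingWord] <;> split_ifs <;> rfl
    refine wordWeight_lt hlen ?_ u v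
    by_cases h : i.val % 2 = 0
    · have h1 : (i.val + 1) % 2 = 1 := by omega
      fin_cases j <;>
        simp [lowerWord, leadingWord, h, h1, wordWeight, letterRank, genIdx] <;> omega
    · have h1 : (i.val + 1) % 2 = 0 := by omega
      fin_cases j <;>
        simp [lowerWord, leadingWord, h, h1, wordWeight, letterRank, genIdx] <;> omega
  disjoint := by
    let a : Fin (n - 2) → Fin n := fun i => if i.val % 2 = 0 then genIdx n i 2 else genIdx n i 1
    let c : Fin (n - 2) → Fin n := fun i => if i.val % 2 = 0 then genIdx n i 1 else genIdx n i 2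
    have hW : ∀ i, leadingWord n i = [a i, genIdx n i 0, c i] := by
      intro i
      simp only [leadingWord, a, c]
      split_ifs <;> rfl
    have ha : ∀ i, (a i).val = if i.val % 2 = 0 then i.val + 2 else i.val + 1 := by
      intro i
      simp only [a]
      split_ifs <;> rfl
    have hc : ∀ i, (c i).val = if i.val % 2 = 0 then i.val + 1 else i.val + 2 := by
      intro i
      simp only [c]
      split_ifs <;> rfl
    have hb : ∀ i, (genIdx n i 0).val = i.val := fun i => rfl
    have key := @occurrence_of_append_eq (Fin n) (Fin (n - 2)) a (genIdx n · 0) c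
      (by
        intro i l h
        have := congrArg Fin.val h
        rw [ha, hc] at this
        split_ifs at this <;> omega)
      (by
        intro i l h h'
        have h := congrArg Fin.val h
        have h' := congrArg Fin.val h'
        simp only [ha, hb, hc] at h h'
        split_ifs at h h' <;> omega)
      (by
        intro i l _ h _
        have h := congrArg Fin.val h
        simp only [hb] at h
        exact Fin.ext h)
    intro u i v u' l v' h
    simp only [hW] at h ⊢
    rw [List.append_assoc, List.append_assoc, List.append_eq_append_iff] at h
    rcases h with ⟨t, rfl, h⟩ | ⟨t, rfl, h⟩
    · rcases key h with ⟨rfl, rfl, rfl⟩ | ⟨s, rfl, rfl⟩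
      · exact .inl ⟨by simp, rfl, rfl⟩
      · exact .inr (.inr ⟨s, by simp, by simp⟩)
    · rcases key h with ⟨rfl, rfl, rfl⟩ | ⟨s, rfl, rfl⟩
      · exact .inl ⟨by simp, rfl, rfl⟩
      · exact .inr (.inl ⟨s, by simp, by simp⟩)

lemma isPresentation_AnAlg (k : Type) [Field k] (n : ℕ) :
    IsPresentation (RingQuot.mkAlgHom k (lieRelRel k n)) fun i => -lieRel k n i :=
  isPresentation_mkAlgHom fun a b => by simp [lieRelRel]

lemma augL_mkAlgHom_ι (k : Type) [Field k] (n : ℕ) (x : Fin n) :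
    augL k n (RingQuot.mkAlgHom k (lieRelRel k n) (FreeAlgebra.ι k x)) = 0 := by
  simp [augL]

open TensorProduct

lemma AnAlg.exists_resolution (k : Type) [Field k] (n : ℕ) (M : Type*) [AddCommGroup M]
    [Module k M] [Module (AnAlg k n) M] [IsScalarTower k (AnAlg k n) M] :
    ∃ (D : FreeAlgebra k (Fin n) →ₗ[k] M →ₗ[k] AnAlg k n ⊗[k] (Fin n →₀ M))
      (f₂ : AnAlg k n ⊗[k] (Fin (n - 2) →₀ M) →ₗ[AnAlg k n] AnAlg k n ⊗[k] (Fin n →₀ M))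
      (f₁ : AnAlg k n ⊗[k] (Fin n →₀ M) →ₗ[AnAlg k n] AnAlg k n ⊗[k] M)
      (f₀ : AnAlg k n ⊗[k] M →ₗ[AnAlg k n] M),
      (∀ a b m, D (a * b) m = RingQuot.mkAlgHom k (lieRelRel k n) a • D b m +
        D a (RingQuot.mkAlgHom k (lieRelRel k n) b • m)) ∧
      (∀ i m, f₂ (1 ⊗ₜ Finsupp.single i m) = D (-lieRel k n i) m) ∧
      Function.Injective f₂ ∧ LinearMap.range f₂ = LinearMap.ker f₁ ∧
      LinearMap.range f₁ = LinearMap.ker f₀ ∧ Function.Surjective f₀ :=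
  (isPresentation_AnAlg k n).exists_resolution
    ((isNonoverlapping_leadingWord n).exists_bimodule_map M (isPresentation_AnAlg k n)
      (neg_lieRel_eq k n))

lemma AnAlg.hasProjDimLE2 (k : Type) [Field k] (n : ℕ) (M : Type u) [AddCommGroup M]
    [Module (AnAlg k n) M] : HasProjDimLE2 (AnAlg k n) M := by
  let _ : Module k M := Module.compHom M (algebraMap k (AnAlg k n))
  have : IsScalarTower k (AnAlg k n) M := .of_algebraMap_smul fun _ _ => rfl
  obtain ⟨-, f₂, f₁, f₀, -, -, h⟩ := AnAlg.exists_resolution k n M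
  exact ⟨.of _ (AnAlg k n ⊗[k] (Fin (n - 2) →₀ M)), .of _ (AnAlg k n ⊗[k] (Fin n →₀ M)),
    .of _ (AnAlg k n ⊗[k] M), inferInstanceAs (Module.Projective _ (AnAlg k n ⊗[k] _)),
    inferInstanceAs (Module.Projective _ (AnAlg k n ⊗[k] _)),
    inferInstanceAs (Module.Projective _ (AnAlg k n ⊗[k] _)), f₂, f₁, f₀, h⟩

/-- A nonzero module on which `Aₙ` acts through the augmentation has projective dimension
greater than one. -/
lemma AnAlg.not_hasProjDimLE1 (k : Type) [Field k] (n : ℕ) (hn : 3 ≤ n) (M : Type u)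
    [AddCommGroup M] [Nontrivial M] [Module k M] [Module (AnAlg k n) M]
    [IsScalarTower k (AnAlg k n) M] (haug : ∀ (a : AnAlg k n) (m : M), a • m = augL k n a • m) :
    ¬ HasProjDimLE1 (AnAlg k n) M := by
  intro hM
  obtain ⟨D, f₂, f₁, f₀, hD, hf₂, inj, ex₁, ex₀, surj⟩ := AnAlg.exists_resolution k n M
  obtain ⟨r, hr⟩ : ∃ r : AnAlg k n ⊗[k] (Fin n →₀ M) →ₗ[AnAlg k n]
      AnAlg k n ⊗[k] (Fin (n - 2) →₀ M), ∀ x, r (f₂ x) = x := by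
    refine HasProjDimLE1.exists_retraction (P₂ := AnAlg k n ⊗[k] (Fin (n - 2) →₀ M))
      (P₁ := AnAlg k n ⊗[k] (Fin n →₀ M)) (P₀ := AnAlg k n ⊗[k] M) hM
      (f₂ := f₂) (f₁ := f₁) (f₀ := f₀) ?_ ?_ ?_ ?_
    · exact inj
    · exact ex₁
    · exact ex₀
    · exact surj
  let q : AnAlg k n ⊗[k] (Fin (n - 2) →₀ M) →ₗ[k] (Fin (n - 2) →₀ M) :=
    TensorProduct.lift ((LinearMap.lsmul k _) ∘ₗ (augL k n).toLinearMap)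
  have hq : ∀ a z, q (a • z) = augL k n a • q z := by
    intro a z
    induction z using TensorProduct.induction_on with
    | zero => simp
    | tmul b m => simp [q, smul_tmul', mul_smul]
    | add y z hy hz => simp only [smul_add, map_add, hy, hz]
  set π := RingQuot.mkAlgHom k (lieRelRel k n)
  let δ : FreeAlgebra k (Fin n) → M → (Fin (n - 2) →₀ M) := fun a m => q (r (D a m))
  have hδ : ∀ a b m, δ (a * b) m = augL k n (π a) • δ b m + δ a (augL k n (π b) • m) := by
    intro a b m
    simp only [δ, hD, map_add, map_smul, hq, haug]
  have hδ₃ : ∀ x y z m,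
      δ (FreeAlgebra.ι k x * FreeAlgebra.ι k y * FreeAlgebra.ι k z) m = 0 := by
    intro x y z m
    have hπ : ∀ x, augL k n (π (FreeAlgebra.ι k x)) = 0 := augL_mkAlgHom_ι k n
    rw [hδ, map_mul, map_mul, hπ y, hπ z, mul_zero, zero_smul, zero_smul, zero_add]
    simp [δ]
  let i : Fin (n - 2) := ⟨0, by omega⟩
  obtain ⟨m, hm⟩ := exists_ne (0 : M)
  have h1 : δ (-lieRel k n i) m = Finsupp.single i m := by
    simp only [δ, ← hf₂, hr]
    simp [q]
  have h2 : δ (-lieRel k n i) m = 0 := by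
    have hadd : ∀ a b, δ (a + b) m = δ a m + δ b m := fun a b => by
      simp only [δ, map_add, LinearMap.add_apply]
    have hrel : -lieRel k n i +
        (FreeAlgebra.ι k (genIdx n i 0) * FreeAlgebra.ι k (genIdx n i 2) *
          FreeAlgebra.ι k (genIdx n i 1) +
        FreeAlgebra.ι k (genIdx n i 1) * FreeAlgebra.ι k (genIdx n i 2) *
          FreeAlgebra.ι k (genIdx n i 0)) =
        FreeAlgebra.ι k (genIdx n i 2) * FreeAlgebra.ι k (genIdx n i 0) *
          FreeAlgebra.ι k (genIdx n i 1) +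
        FreeAlgebra.ι k (genIdx n i 1) * FreeAlgebra.ι k (genIdx n i 0) *
          FreeAlgebra.ι k (genIdx n i 2) := by
      simp only [lieRel]
      abel
    simpa only [hadd, hδ₃, add_zero] using congrArg (δ · m) hrel
  exact hm (Finsupp.single_eq_zero.1 (h1.symm.trans h2))

end LieRelations

/-- the algebra `Aₙ = k⟨x_1,…,x_n⟩/([[x_i,x_{i+2}],x_{i+1}])` has global
dimension 2: every left `Aₙ`-module has projective dimension at most 2, and some
`Aₙ`-module has projective dimension exactly 2. -/
theorem An_global_dimension_two
    (k : Type) [Field k] (n : ℕ) (hn : 3 ≤ n) :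
    (∀ (M : Type u) [AddCommGroup M] [Module (AnAlg k n) M],
        HasProjDimLE2 (AnAlg k n) M) ∧
    (∃ M : ModuleCat.{u} (AnAlg k n),
        HasProjDimLE2 (AnAlg k n) M ∧ ¬ HasProjDimLE1 (AnAlg k n) M) := by
  refine ⟨fun M _ _ => AnAlg.hasProjDimLE2 k n M, ?_⟩
  let _ : Module (AnAlg k n) (ULift.{u} k) := Module.compHom _ (augL k n).toRingHom
  have : IsScalarTower k (AnAlg k n) (ULift.{u} k) := .of_algebraMap_smul fun r m => by
    change augL k n (algebraMap k (AnAlg k n) r) • m = r • m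
    rw [AlgHom.commutes]
    rfl
  exact ⟨.of (AnAlg k n) (ULift.{u} k), AnAlg.hasProjDimLE2 k n _,
    AnAlg.not_hasProjDimLE1 k n hn (ULift.{u} k) fun _ _ => rfl⟩

end
end

section
/- Let k be a field and n ≥ 3 an integer, and let Aₙ be the quotient of the free associative unital k-algebra on x₁,…,xₙ by the two-sided ideal generated by [[x_i, x_{i+2}], x_{i+1}], i = 1,…,n−2. Let ε : Aₙ → k be the augmentation, let g : Aₙ^n → Aₙ be the right Aₙ-module map g(a₁,…,aₙ) = Σ_{j=1}^n x̄_j a_j, and let f : Aₙ^{n−2} → Aₙ^n be the right Aₙ-module map whose j-th component on (b₁,…,b_{n−2}) equals Σ_{i=1}^{n−2} p̄_{ij} b_i, where p_{i,i} = x_{i+2} x_{i+1}, p_{i,i+1} = x_{i+2} x_i − x_i x_{i+2}, p_{i,i+2} = −x_i x_{i+1}, and p_{ij} = 0 for all other j. Then the sequence of right Aₙ-modules 0 → Aₙ^{n−2} → Aₙ^n → Aₙ → k → 0 (with maps f, g, ε) is exact: ε is surjective, ker ε = im g, ker g = im f, and f is injective. In particular, the trivial Aₙ-module k admits a minimal free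 resolution with n generators in homological degree 1 and n−2 generators in homological degree 2. -/
open scoped BigOperators

noncomputable section

universe u

section

variable {k : Type} [Field k] {n : ℕ}

theorem AnAlg_induction {C : AnAlg k n → Prop} (algebraMap : ∀ c, C (algebraMap k _ c))
    (gen : ∀ j, C (XbarL k n j)) (add : ∀ a b, C a → C b → C (a + b))
    (mul : ∀ a b, C a → C b → C (a * b)) (a : AnAlg k n) : C a := by
  obtain ⟨a, rfl⟩ := RingQuot.mkAlgHom_surjective k (lieRelRel k n) a
  induction a using FreeAlgebra.induction with
  | grade0 c => simpa using algebraMap c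
  | grade1 j => exact gen j
  | mul a b ha hb => simpa using mul _ _ ha hb
  | add a b ha hb => simpa using add _ _ ha hb

/-- The universal property of `AnAlg k n`. -/
def AnAlg_lift {B : Type} [Ring B] [Algebra k B] (y : Fin n → B)
    (hy : ∀ i : Fin (n - 2),
      y (genIdx n i 0) * y (genIdx n i 2) * y (genIdx n i 1)
        - y (genIdx n i 2) * y (genIdx n i 0) * y (genIdx n i 1)
        - y (genIdx n i 1) * y (genIdx n i 0) * y (genIdx n i 2)
        + y (genIdx n i 1) * y (genIdx n i 2) * y (genIdx n i 0) = 0) :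
    AnAlg k n →ₐ[k] B :=
  RingQuot.liftAlgHom k ⟨FreeAlgebra.lift k y, by
    rintro a b ⟨rfl, i, rfl⟩
    simpa [lieRel] using hy i⟩

@[simp]
theorem AnAlg_lift_XbarL {B : Type} [Ring B] [Algebra k B] (y : Fin n → B) (hy) (j : Fin n) :
    AnAlg_lift (k := k) y hy (XbarL k n j) = y j := by
  simp [AnAlg_lift, XbarL]

@[simp]
theorem augL_XbarL (j : Fin n) : augL k n (XbarL k n j) = 0 := by
  simp [augL, XbarL]

theorem XbarL_relation (i : Fin (n - 2)) :
    XbarL k n (genIdx n i 0) * XbarL k n (genIdx n i 2) * XbarL k n (genIdx n i 1)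
      - XbarL k n (genIdx n i 2) * XbarL k n (genIdx n i 0) * XbarL k n (genIdx n i 1)
      - XbarL k n (genIdx n i 1) * XbarL k n (genIdx n i 0) * XbarL k n (genIdx n i 2)
      + XbarL k n (genIdx n i 1) * XbarL k n (genIdx n i 2) * XbarL k n (genIdx n i 0) = 0 := by
  have h := RingQuot.mkAlgHom_rel k (s := lieRelRel k n) ⟨rfl, i, rfl⟩
  simpa [lieRel, XbarL] using h

theorem genIdx_injective (i : Fin (n - 2)) : Function.Injective (genIdx n i) := by
  intro s t h
  simpa [genIdx, Fin.ext_iff] using h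

theorem PbarL_genIdx_zero (i : Fin (n - 2)) :
    PbarL k n i (genIdx n i 0) = XbarL k n (genIdx n i 2) * XbarL k n (genIdx n i 1) := by
  simp [PbarL, pLie, XbarL]

theorem PbarL_eq_zero_of_lt {i : Fin (n - 2)} {j : Fin n} (h : j.val < i.val) :
    PbarL k n i j = 0 := by
  have hne (t : Fin 3) : j ≠ genIdx n i t := by
    rintro rfl
    simp [genIdx] at h
  simp [PbarL, pLie, hne]

/-- The `i`-th row of the matrix `p̄`. -/
theorem PbarL_eq_single (i : Fin (n - 2)) :
    PbarL k n i =
      Pi.single (genIdx n i 0) (XbarL k n (genIdx n i 2) * XbarL k n (genIdx n i 1))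
      + Pi.single (genIdx n i 1) (XbarL k n (genIdx n i 2) * XbarL k n (genIdx n i 0)
          - XbarL k n (genIdx n i 0) * XbarL k n (genIdx n i 2))
      - Pi.single (genIdx n i 2) (XbarL k n (genIdx n i 0) * XbarL k n (genIdx n i 1)) := by
  have h01 := (genIdx_injective i).ne (show (0 : Fin 3) ≠ 1 by decide)
  have h02 := (genIdx_injective i).ne (show (0 : Fin 3) ≠ 2 by decide)
  have h12 := (genIdx_injective i).ne (show (1 : Fin 3) ≠ 2 by decide)
  funext j
  by_cases h0 : j = genIdx n i 0
  · subst h0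
    simp [PbarL, pLie, XbarL, h01, h02]
  by_cases h1 : j = genIdx n i 1
  · subst h1
    simp [PbarL, pLie, XbarL, h01.symm, h12]
  by_cases h2 : j = genIdx n i 2
  · subst h2
    simp [PbarL, pLie, XbarL, h02.symm, h12.symm]
  simp [PbarL, pLie, h0, h1, h2]

theorem sum_XbarL_mul_PbarL (i : Fin (n - 2)) :
    ∑ j, XbarL k n j * PbarL k n i j = 0 := by
  rw [PbarL_eq_single, ← XbarL_relation (k := k) i]
  simp only [Pi.add_apply, Pi.sub_apply, mul_add, mul_sub, Finset.sum_add_distrib,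
    Finset.sum_sub_distrib, Pi.single_apply, mul_ite, mul_zero, Finset.sum_ite_eq',
    Finset.mem_univ, if_true]
  noncomm_ring

/-- The double commutator `[[u, v], w]` does not change under translation by central elements. -/
theorem commutator_commutator_add_of_commute {R : Type*} [Ring R] {r s t : R}
    (hr : ∀ p, Commute r p) (hs : ∀ p, Commute s p) (ht : ∀ p, Commute t p) (u v w : R) :
    (u + r) * (v + s) * (w + t) - (v + s) * (u + r) * (w + t) - (w + t) * (u + r) * (v + s)
      + (w + t) * (v + s) * (u + r) = u * v * w - v * u * w - w * u * v + w * v * u := by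
  have h : (u + r) * (v + s) - (v + s) * (u + r) = u * v - v * u := by
    simp only [add_mul, mul_add, (hr v).eq, (hs u).eq, (hs r).eq]
    abel
  calc
    _ = ((u + r) * (v + s) - (v + s) * (u + r)) * (w + t)
        - (w + t) * ((u + r) * (v + s) - (v + s) * (u + r)) := by
      simp only [sub_mul, mul_sub, mul_assoc]
      abel
    _ = _ := by
      rw [h, add_mul, mul_add, (ht _).eq]
      simp only [sub_mul, mul_sub, mul_assoc]
      abel

open Polynomial in
/-- The algebra map `Aₙ → Aₙ[t]` sending `x̄_m` to `x̄_m + t` and fixing the other generators; it is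
well defined because the relations are Lie polynomials of degree at least two. -/
def shiftHom (m : Fin n) : AnAlg k n →ₐ[k] (AnAlg k n)[X] :=
  AnAlg_lift (fun j => C (XbarL k n j) + if j = m then X else 0) fun i => by
    have h := congrArg (C : AnAlg k n →+* (AnAlg k n)[X]) (XbarL_relation (k := k) i)
    simp only [map_add, map_sub, map_mul, map_zero] at h
    have hc (j : Fin n) (p : (AnAlg k n)[X]) :
        Commute (if j = m then (X : (AnAlg k n)[X]) else 0) p := by
      split_ifs
      exacts [commute_X p, Commute.zero_left p]
    refine (commutator_commutator_add_of_commute (R := (AnAlg k n)[X])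
      (hc _) (hc _) (hc _) _ _ _).trans ?_
    exact h

open Polynomial in
theorem XbarL_mul_eq_zero {m : Fin n} {a : AnAlg k n} (h : XbarL k n m * a = 0) : a = 0 := by
  have hmonic : (C (XbarL k n m) + X : (AnAlg k n)[X]).Monic := by
    rw [add_comm]; exact monic_X_add_C _
  have hzero : shiftHom m a = 0 := by
    have := congrArg (shiftHom m) h
    rw [map_mul, map_zero] at this
    simp only [shiftHom, AnAlg_lift_XbarL, if_true] at this
    exact (hmonic.mul_right_eq_zero_iff).1 this
  have heval (b : AnAlg k n) : constantCoeff (shiftHom m b) = b := by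
    induction b using AnAlg_induction with
    | algebraMap c => simp [Polynomial.algebraMap_apply]
    | gen j =>
      simp only [shiftHom, AnAlg_lift_XbarL]
      split_ifs <;> simp
    | add a b ha hb => rw [map_add, map_add, ha, hb]
    | mul a b ha hb => rw [map_mul, map_mul, ha, hb]
  rw [← heval a, hzero, map_zero]

theorem eq_augL_add_sum (a : AnAlg k n) :
    ∃ v : Fin n → AnAlg k n,
      a = algebraMap k _ (augL k n a) + ∑ j, XbarL k n j * v j := by
  induction a using AnAlg_induction with
  | algebraMap c => exact ⟨0, by simp⟩
  | gen j => exact ⟨Pi.single j 1, by simp [Pi.single_apply]⟩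
  | add a b ha hb =>
    obtain ⟨v, hv⟩ := ha
    obtain ⟨w, hw⟩ := hb
    refine ⟨v + w, ?_⟩
    conv_lhs => rw [hv, hw]
    simp only [map_add, Pi.add_apply, mul_add, Finset.sum_add_distrib]
    abel
  | mul a b ha hb =>
    obtain ⟨v, hv⟩ := ha
    obtain ⟨w, hw⟩ := hb
    refine ⟨fun j => v j * b + w j * algebraMap k _ (augL k n a), ?_⟩
    conv_lhs => rw [hv, add_mul]
    have hb : algebraMap k _ (augL k n a) * b = algebraMap k _ (augL k n (a * b)) +
        ∑ j, XbarL k n j * (w j * algebraMap k _ (augL k n a)) := by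
      simp only [← mul_assoc, ← Finset.sum_mul]
      rw [Algebra.commutes]
      conv_lhs => rw [hw, add_mul]
      rw [map_mul, map_mul, ← Algebra.commutes (augL k n a) (algebraMap k _ _)]
    simp only [hb, Finset.sum_mul, mul_add, Finset.sum_add_distrib, mul_assoc]
    abel

variable (k n) in
/-- The image of `f`, as a right submodule of `Aₙⁿ`. -/
def relationModule : Submodule (AnAlg k n)ᵐᵒᵖ (Fin n → AnAlg k n) :=
  Submodule.span _ (Set.range (PbarL k n))

theorem mem_relationModule {v : Fin n → AnAlg k n} :
    v ∈ relationModule k n ↔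
      ∃ b : Fin (n - 2) → AnAlg k n, ∀ j, v j = ∑ i, PbarL k n i j * b i := by
  rw [relationModule, Submodule.mem_span_range_iff_exists_fun]
  constructor
  · rintro ⟨c, rfl⟩
    exact ⟨fun i => (c i).unop, fun j => by simp⟩
  · rintro ⟨b, hb⟩
    exact ⟨fun i => MulOpposite.op (b i), funext fun j => by simp [hb]⟩

variable (k n) in
/-- The right `Aₙ`-module `Aₙⁿ / im f`, in which a Fox-type derivative of `Aₙ` takes its values. -/
def FoxModule : Type := (Fin n → AnAlg k n) ⧸ relationModule k n

instance : AddCommGroup (FoxModule k n) :=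
  inferInstanceAs (AddCommGroup ((Fin n → AnAlg k n) ⧸ relationModule k n))

instance : Module (AnAlg k n)ᵐᵒᵖ (FoxModule k n) :=
  inferInstanceAs (Module (AnAlg k n)ᵐᵒᵖ ((Fin n → AnAlg k n) ⧸ relationModule k n))

instance : Module k (FoxModule k n) :=
  Module.compHom _ (algebraMap k (AnAlg k n)ᵐᵒᵖ)

instance : IsScalarTower k (AnAlg k n)ᵐᵒᵖ (FoxModule k n) :=
  IsScalarTower.of_algebraMap_smul fun _ _ => rfl

variable (k n) in
/-- The quotient map `Aₙⁿ → Aₙⁿ / im f`. -/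
def foxMk : (Fin n → AnAlg k n) →ₗ[(AnAlg k n)ᵐᵒᵖ] FoxModule k n :=
  (relationModule k n).mkQ

theorem foxMk_eq_zero {v : Fin n → AnAlg k n} : foxMk k n v = 0 ↔ v ∈ relationModule k n :=
  Submodule.Quotient.mk_eq_zero _

/-- Right multiplication by `x̄_j` on `k ⊕ Aₙⁿ / im f`, where `1 ∈ k` is sent to the `j`-th basis
vector. -/
def foxGen (j : Fin n) : Module.End k (k × FoxModule k n) :=
  LinearMap.inr k k (FoxModule k n) ∘ₗ
    (LinearMap.coprod
      (LinearMap.toSpanSingleton k _ (foxMk k n (Pi.single j 1)))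
      (Algebra.lsmul k k (FoxModule k n) (MulOpposite.op (XbarL k n j))))

theorem foxGen_apply (j : Fin n) (c : k) (m : FoxModule k n) :
    foxGen j (c, m) =
      (0, c • foxMk k n (Pi.single j 1) + MulOpposite.op (XbarL k n j) • m) := by
  simp [foxGen]

/-- The right action of `Aₙ` on `k ⊕ Aₙⁿ / im f`. -/
def foxHom : AnAlg k n →ₐ[k] (Module.End k (k × FoxModule k n))ᵐᵒᵖ :=
  AnAlg_lift (fun j => MulOpposite.op (foxGen j)) fun i => by
    apply MulOpposite.unop_injective
    refine LinearMap.ext fun ⟨c, m⟩ => ?_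
    have hP : foxMk k n (PbarL k n i) = 0 :=
      foxMk_eq_zero.2 (Submodule.subset_span ⟨i, rfl⟩)
    have hs (j : Fin n) (a : AnAlg k n) : Pi.single j a =
        MulOpposite.op a • (Pi.single j 1 : Fin n → AnAlg k n) := by
      simp [← Pi.single_smul]
    rw [PbarL_eq_single, map_sub, map_add, hs _ (_ * _), hs _ (_ - _), hs (genIdx n i 2)] at hP
    have hm := congrArg (fun a => MulOpposite.op a • m) (XbarL_relation (k := k) i)
    replace hP := congrArg (c • ·) hP
    simp only [map_smul, MulOpposite.op_sub, MulOpposite.op_add, MulOpposite.op_mul, sub_smul,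
      mul_smul, add_smul, smul_add, smul_sub, smul_zero, MulOpposite.op_zero, zero_smul] at hP hm
    simp only [MulOpposite.unop_sub, MulOpposite.unop_add, MulOpposite.unop_mul,
      MulOpposite.unop_op, MulOpposite.unop_zero, LinearMap.add_apply, LinearMap.sub_apply,
      LinearMap.zero_apply, Module.End.mul_apply, foxGen_apply, smul_add, zero_smul, zero_add,
      smul_comm _ c, Prod.mk_sub_mk, Prod.mk_add_mk, sub_zero, add_zero]
    refine Prod.ext rfl ?_
    rw [Prod.snd_zero, ← add_zero (0 : FoxModule k n)]
    nth_rewrite 1 [← hP]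
    rw [← hm]
    dsimp only
    abel

theorem foxHom_apply_inr (a : AnAlg k n) (m : FoxModule k n) :
    (foxHom a).unop (0, m) = (0, MulOpposite.op a • m) := by
  induction a using AnAlg_induction generalizing m with
  | algebraMap c =>
    rw [AlgHom.commutes, MulOpposite.algebraMap_apply, MulOpposite.unop_op,
      Module.algebraMap_end_apply, Prod.smul_mk, smul_zero, ← MulOpposite.algebraMap_apply,
      algebraMap_smul]
  | gen j => rw [foxHom, AnAlg_lift_XbarL, MulOpposite.unop_op, foxGen_apply, zero_smul, zero_add]
  | add a b ha hb => simp [ha, hb, add_smul]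
  | mul a b ha hb => simp [ha, hb, mul_smul]

theorem foxHom_sum (v : Fin n → AnAlg k n) :
    (foxHom (∑ j, XbarL k n j * v j)).unop (1, 0) = (0, foxMk k n v) := by
  have h (j : Fin n) : (foxHom (XbarL k n j * v j)).unop (1, 0) =
      (0, foxMk k n (Pi.single j (v j))) := by
    rw [map_mul, MulOpposite.unop_mul, Module.End.mul_apply]
    have : (foxHom (XbarL k n j)).unop (1, 0) =
        (0, foxMk k n (Pi.single j 1)) := by
      rw [foxHom, AnAlg_lift_XbarL, MulOpposite.unop_op, foxGen_apply, one_smul, smul_zero, add_zero]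
    rw [this, foxHom_apply_inr, ← map_smul, ← Pi.single_smul]
    simp
  rw [map_sum, Finset.unop_sum, LinearMap.sum_apply, Finset.sum_congr rfl fun j _ => h j]
  conv_rhs => rw [← Finset.univ_sum_single v]
  rw [map_sum]
  ext <;> simp [Prod.fst_sum, Prod.snd_sum]

theorem eq_zero_of_sum_PbarL_mul {b : Fin (n - 2) → AnAlg k n}
    (h : ∀ j, (∑ i, PbarL k n i j * b i) = 0) (i : Fin (n - 2)) : b i = 0 := by
  induction i using WellFoundedLT.induction with
  | ind i ih =>
    have hi := h (genIdx n i 0)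
    rw [Finset.sum_eq_single i, PbarL_genIdx_zero, mul_assoc] at hi
    · exact XbarL_mul_eq_zero (XbarL_mul_eq_zero hi)
    · intro l _ hl
      rcases lt_or_gt_of_ne hl with hl | hl
      · rw [ih l hl, mul_zero]
      · rw [PbarL_eq_zero_of_lt (by simpa [genIdx] using hl), zero_mul]
    · simp

end

/-- the sequence of (right) `Aₙ`-modules
`0 → Aₙ^{n-2} -f→ Aₙ^n -g→ Aₙ -ε→ k → 0`, with `g(a₁,…,aₙ) = Σ_j x̄_j a_j` and with the
`j`-th component of `f(b₁,…,b_{n-2})` equal to `Σ_i p̄_{ij} b_i`, is exact: `ε` is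
surjective, `ker ε = im g`, `ker g = im f`, and `f` is injective. -/
theorem An_resolution_exact
    (k : Type) [Field k] (n : ℕ) (hn : 3 ≤ n) :
    Function.Surjective (augL k n) ∧
    (∀ a : AnAlg k n,
        augL k n a = 0 ↔ ∃ v : Fin n → AnAlg k n, a = ∑ j, XbarL k n j * v j) ∧
    (∀ v : Fin n → AnAlg k n,
        (∑ j, XbarL k n j * v j) = 0 ↔
          ∃ b : Fin (n - 2) → AnAlg k n, ∀ j, v j = ∑ i, PbarL k n i j * b i) ∧
    (∀ b : Fin (n - 2) → AnAlg k n,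
        (∀ j, (∑ i, PbarL k n i j * b i) = 0) → b = 0) := by
  refine ⟨fun c => ⟨algebraMap k _ c, by simp⟩, fun a => ⟨fun ha => ?_, ?_⟩,
    fun v => ⟨fun hv => ?_, ?_⟩, fun b hb => funext (eq_zero_of_sum_PbarL_mul hb)⟩
  · obtain ⟨v, hv⟩ := eq_augL_add_sum a
    exact ⟨v, by simpa [ha] using hv⟩
  · rintro ⟨v, rfl⟩
    simp
  · have h := foxHom_sum v
    rw [hv, map_zero] at h
    exact mem_relationModule.1 (foxMk_eq_zero.1 (congrArg Prod.snd h).symm)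
  · rintro ⟨b, hb⟩
    simp_rw [hb, Finset.mul_sum]
    rw [Finset.sum_comm]
    simp_rw [← mul_assoc, ← Finset.sum_mul, sum_XbarL_mul_PbarL, zero_mul, Finset.sum_const_zero]

end
end

section
/- Let k be a field and n ≥ 3 an integer, and let Aₙ be the quotient of the free associative unital k-algebra on x₁,…,xₙ by the two-sided ideal generated by [[x_i, x_{i+2}], x_{i+1}], i = 1,…,n−2. Set p_{i,i} = x_{i+2} x_{i+1}, p_{i,i+1} = x_{i+2} x_i − x_i x_{i+2}, p_{i,i+2} = −x_i x_{i+1}, and p_{ij} = 0 for other j. If elements b₁,…,b_{n−2} ∈ Aₙ satisfy Σ_{i=1}^{n−2} p̄_{ij} b_i = 0 in Aₙ for every j = 1,…,n, then b₁ = … = b_{n−2} = 0. -/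
open scoped BigOperators

noncomputable section

universe u

/-- Prepending the letter `u` to a word, extended linearly. -/
def consLin (k : Type) [Field k] {α : Type} (u : α) : (List α →₀ k) →ₗ[k] (List α →₀ k) :=
  Finsupp.lmapDomain k k (List.cons u)

/-- The action of the letter `z` on a word: prepend `z`, then push it to the right past two letters
by means of the relation, solved for its monomial `x_z x_{z+2} x_{z+1}`, `x_z x_{z-1} x_{z+1}` or
`x_z x_{z-2} x_{z-1}`, whenever one of these is a prefix. -/
def pushLetter (k : Type) [Field k] {n : ℕ} (z : Fin n) : List (Fin n) → (List (Fin n) →₀ k)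
  | [] => Finsupp.single [z] 1
  | [u] => Finsupp.single [z, u] 1
  | u :: v :: w =>
    if u.val = z.val + 2 ∧ v.val = z.val + 1 then
      consLin k u (pushLetter k z (v :: w)) + consLin k v (pushLetter k z (u :: w))
        - consLin k v (consLin k u (pushLetter k z w))
    else if u.val + 1 = z.val ∧ v.val = z.val + 1 then
      Finsupp.single (z :: v :: u :: w) 1 + consLin k u (consLin k v (pushLetter k z w))
        - consLin k v (consLin k u (pushLetter k z w))
    else if u.val + 2 = z.val ∧ v.val + 1 = z.val then
      consLin k u (pushLetter k z (v :: w)) + consLin k v (pushLetter k z (u :: w))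
        - consLin k v (consLin k u (pushLetter k z w))
    else Finsupp.single (z :: u :: v :: w) 1
  termination_by l => l.length

/-- The action of a generator on the space spanned by all words: generators whose index is
divisible by `3` act by `pushLetter`, the others by prepending. -/
def letterAct (k : Type) [Field k] {n : ℕ} (j : Fin n) : Module.End k (List (Fin n) →₀ k) :=
  if j.val % 3 = 0 then Finsupp.linearCombination k (pushLetter k j) else consLin k j

section

variable {k : Type} [Field k] {n : ℕ}

theorem consLin_single {α : Type} (u : α) (w : List α) (c : k) :
    consLin k u (Finsupp.single w c) = Finsupp.single (u :: w) c := by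
  simp [consLin]

theorem consLin_apply_cons {α : Type} [DecidableEq α] (u v : α) (w : List α) (y : List α →₀ k) :
    consLin k u y (v :: w) = if u = v then y w else 0 := by
  classical
  induction y using Finsupp.induction_linear with
  | zero => simp
  | add f g hf hg => rw [map_add, Finsupp.add_apply, hf, hg]; split_ifs <;> simp
  | single a c =>
    rw [consLin_single, Finsupp.single_apply, Finsupp.single_apply]
    by_cases h : u = v <;> simp [h]

theorem letterAct_of_mod {j : Fin n} (hj : j.val % 3 ≠ 0) : letterAct k j = consLin k j :=
  if_neg hj

theorem letterAct_single {j : Fin n} (hj : j.val % 3 = 0) (w : List (Fin n)) :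
    letterAct k j (Finsupp.single w 1) = pushLetter k j w := by
  rw [letterAct, if_pos hj, Finsupp.linearCombination_single, one_smul]

theorem lift_letterAct_lieRel (i : Fin (n - 2)) :
    FreeAlgebra.lift k (letterAct k) (lieRel k n i) = 0 := by
  have h0 : (genIdx n i 0).val = i.val := rfl
  have h1 : (genIdx n i 1).val = i.val + 1 := rfl
  have h2 : (genIdx n i 2).val = i.val + 2 := rfl
  simp only [lieRel, map_add, map_sub, map_mul, FreeAlgebra.lift_ι_apply]
  generalize genIdx n i 0 = a at *
  generalize genIdx n i 1 = b at *
  generalize genIdx n i 2 = c at *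
  refine Finsupp.lhom_ext' fun w => LinearMap.ext_ring ?_
  have hmod : i.val % 3 = 0 ∨ i.val % 3 = 1 ∨ i.val % 3 = 2 := by omega
  simp only [LinearMap.comp_apply, LinearMap.add_apply, LinearMap.sub_apply, Module.End.mul_apply,
    Finsupp.lsingle_apply, LinearMap.zero_apply]
  rcases hmod with h | h | h
  · have ha : a.val % 3 = 0 := by omega
    have hb : b.val % 3 ≠ 0 := by omega
    have hc : c.val % 3 ≠ 0 := by omega
    simp only [letterAct_of_mod hb, letterAct_of_mod hc, consLin_single, letterAct_single ha]
    rw [pushLetter, if_pos (by omega)]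
    abel
  · have ha : a.val % 3 ≠ 0 := by omega
    have hb : b.val % 3 ≠ 0 := by omega
    have hc : c.val % 3 = 0 := by omega
    simp only [letterAct_of_mod ha, letterAct_of_mod hb, consLin_single, letterAct_single hc]
    rw [pushLetter.eq_3 k c a b w, if_neg (by omega), if_neg (by omega), if_pos (by omega)]
    abel
  · have ha : a.val % 3 ≠ 0 := by omega
    have hb : b.val % 3 = 0 := by omega
    have hc : c.val % 3 ≠ 0 := by omega
    simp only [letterAct_of_mod ha, letterAct_of_mod hc, consLin_single, letterAct_single hb]
    rw [pushLetter.eq_3 k b a c w, pushLetter.eq_3 k b c a w, if_neg (by omega), if_pos (by omega),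
      if_neg (by omega), if_neg (by omega), if_neg (by omega)]
    abel

variable (k n) in
/-- The representation of `Aₙ` on the space spanned by all words. -/
def wordRep : AnAlg k n →ₐ[k] Module.End k (List (Fin n) →₀ k) :=
  RingQuot.liftAlgHom k ⟨FreeAlgebra.lift k (letterAct k), by
    rintro a b ⟨rfl, i, rfl⟩
    rw [lift_letterAct_lieRel, map_zero]⟩

theorem wordRep_mk (f : FreeAlgebra k (Fin n)) :
    wordRep k n (RingQuot.mkAlgHom k (lieRelRel k n) f) = FreeAlgebra.lift k (letterAct k) f := by
  simp [wordRep]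

variable (k n) in
/-- The linear map sending a word to the corresponding monomial of `Aₙ`. -/
def wordEval : (List (Fin n) →₀ k) →ₗ[k] AnAlg k n :=
  Finsupp.linearCombination k fun w => (w.map (XbarL k n)).prod

theorem wordEval_single (w : List (Fin n)) :
    wordEval k n (Finsupp.single w 1) = (w.map (XbarL k n)).prod := by
  rw [wordEval, Finsupp.linearCombination_single, one_smul]

theorem wordEval_consLin (u : Fin n) (y : List (Fin n) →₀ k) :
    wordEval k n (consLin k u y) = XbarL k n u * wordEval k n y := by
  induction y using Finsupp.induction_linear with
  | zero => simp
  | add f g hf hg => simp only [map_add, hf, hg, mul_add]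
  | single a c => simp [wordEval, consLin_single]

theorem XbarL_relation_s6 {a b c : Fin n} (hb : b.val = a.val + 1) (hc : c.val = a.val + 2) :
    XbarL k n a * XbarL k n c * XbarL k n b - XbarL k n c * XbarL k n a * XbarL k n b
      - XbarL k n b * XbarL k n a * XbarL k n c + XbarL k n b * XbarL k n c * XbarL k n a = 0 := by
  have hlt : a.val < n - 2 := by omega
  have h0 : a = genIdx n ⟨a.val, hlt⟩ 0 := rfl
  have h1 : b = genIdx n ⟨a.val, hlt⟩ 1 := Fin.ext hb
  have h2 : c = genIdx n ⟨a.val, hlt⟩ 2 := Fin.ext hc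
  have h := RingQuot.mkAlgHom_rel k
    (show lieRelRel k n (lieRel k n ⟨a.val, hlt⟩) 0 from ⟨rfl, _, rfl⟩)
  simpa only [lieRel, XbarL, map_add, map_sub, map_mul, map_zero, ← h0, ← h1, ← h2] using h

theorem wordEval_pushLetter (z : Fin n) (w : List (Fin n)) :
    wordEval k n (pushLetter k z w) = XbarL k n z * (w.map (XbarL k n)).prod := by
  induction w using pushLetter.induct z with
  | case1 => simp [pushLetter, wordEval_single]
  | case2 u => simp [pushLetter, wordEval_single]
  | case3 u v w h ih1 ih2 ih3 =>
    rw [pushLetter, if_pos h]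
    simp only [map_add, map_sub, wordEval_consLin, ih1, ih2, ih3, List.map_cons, List.prod_cons]
    have hr := congrArg (· * (w.map (XbarL k n)).prod) (XbarL_relation_s6 (k := k) h.2 h.1)
    simp only [add_mul, sub_mul, zero_mul, mul_assoc] at hr
    rw [← sub_eq_zero, ← neg_eq_zero, ← hr]
    abel
  | case4 u v w h1 h ih =>
    rw [pushLetter, if_neg h1, if_pos h]
    simp only [map_add, map_sub, wordEval_consLin, wordEval_single, ih, List.map_cons,
      List.prod_cons]
    have hr := congrArg (· * (w.map (XbarL k n)).prod)
      (XbarL_relation_s6 (k := k) (a := u) (b := z) (c := v) (by omega) (by omega))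
    simp only [add_mul, sub_mul, zero_mul, mul_assoc] at hr
    rw [← sub_eq_zero, ← hr]
    abel
  | case5 u v w h1 h2 h ih1 ih2 ih3 =>
    rw [pushLetter, if_neg h1, if_neg h2, if_pos h]
    simp only [map_add, map_sub, wordEval_consLin, ih1, ih2, ih3, List.map_cons, List.prod_cons]
    have hr := congrArg (· * (w.map (XbarL k n)).prod)
      (XbarL_relation_s6 (k := k) (a := u) (b := v) (c := z) (by omega) (by omega))
    simp only [add_mul, sub_mul, zero_mul, mul_assoc] at hr
    rw [← sub_eq_zero, ← hr]
    abel
  | case6 u v w h1 h2 h3 =>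
    rw [pushLetter, if_neg h1, if_neg h2, if_neg h3]
    simp [wordEval_single]

theorem wordEval_letterAct (j : Fin n) (y : List (Fin n) →₀ k) :
    wordEval k n (letterAct k j y) = XbarL k n j * wordEval k n y := by
  by_cases hj : j.val % 3 = 0
  · induction y using Finsupp.induction_linear with
    | zero => simp
    | add f g hf hg => simp only [map_add, hf, hg, mul_add]
    | single a c =>
      rw [← mul_one c, ← smul_eq_mul, ← Finsupp.smul_single]
      simp only [map_smul, letterAct_single hj, wordEval_pushLetter, wordEval_single,
        mul_smul_comm]
  · rw [letterAct_of_mod hj, wordEval_consLin]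

theorem wordEval_wordRep (a : AnAlg k n) (y : List (Fin n) →₀ k) :
    wordEval k n (wordRep k n a y) = a * wordEval k n y := by
  obtain ⟨f, rfl⟩ := RingQuot.mkAlgHom_surjective k (lieRelRel k n) a
  rw [wordRep_mk]
  induction f using FreeAlgebra.induction generalizing y with
  | grade0 r => simp [Algebra.smul_def]
  | grade1 j => rw [FreeAlgebra.lift_ι_apply, wordEval_letterAct]; rfl
  | mul f g hf hg => rw [map_mul, Module.End.mul_apply, hf, hg, map_mul, mul_assoc]
  | add f g hf hg => rw [map_add, LinearMap.add_apply, map_add, hf, hg, map_add, add_mul]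

theorem eq_zero_of_wordRep_nil {a : AnAlg k n}
    (h : wordRep k n a (Finsupp.single [] 1) = 0) : a = 0 := by
  simpa [h, wordEval_single] using (wordEval_wordRep a (Finsupp.single [] 1)).symm

/-- For `3 ∣ j`, the element `p̄_{ij}` acts by prepending pairs of letters. -/
theorem wordRep_PbarL_apply {j : Fin n} (hj : j.val % 3 = 0) (i : Fin (n - 2))
    (y : List (Fin n) →₀ k) (u v : Fin n) (w : List (Fin n)) :
    wordRep k n (PbarL k n i j) y (u :: v :: w) =
      if j.val = i.val then if u.val = i.val + 2 ∧ v.val = i.val + 1 then y w else 0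
      else if j.val = i.val + 1 then
        (if u.val = i.val + 2 ∧ v.val = i.val then y w else 0)
          - if u.val = i.val ∧ v.val = i.val + 2 then y w else 0
      else if j.val = i.val + 2 then -(if u.val = i.val ∧ v.val = i.val + 1 then y w else 0)
      else 0 := by
  have h0 : (genIdx n i 0).val = i.val := rfl
  have h1 : (genIdx n i 1).val = i.val + 1 := rfl
  have h2 : (genIdx n i 2).val = i.val + 2 := rfl
  rw [PbarL, wordRep_mk, pLie]
  have two (p q : Fin n) (hp : p.val % 3 ≠ 0) (hq : q.val % 3 ≠ 0) :
      (letterAct k p (letterAct k q y)) (u :: v :: w) =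
        if u.val = p.val ∧ v.val = q.val then y w else 0 := by
    rw [letterAct_of_mod hp, letterAct_of_mod hq, consLin_apply_cons, consLin_apply_cons,
      ← ite_and]
    simp only [Fin.ext_iff, eq_comm]
  simp only [Fin.ext_iff, h0, h1, h2]
  by_cases e0 : j.val = i.val
  · simp only [if_pos e0, map_mul, FreeAlgebra.lift_ι_apply, Module.End.mul_apply]
    rw [two _ _ (by omega) (by omega), h1, h2]
  by_cases e1 : j.val = i.val + 1
  · simp only [if_neg e0, if_pos e1, map_sub, map_mul, FreeAlgebra.lift_ι_apply,
      Module.End.mul_apply, LinearMap.sub_apply, Finsupp.sub_apply]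
    rw [two _ _ (by omega) (by omega), two _ _ (by omega) (by omega), h0, h2]
  by_cases e2 : j.val = i.val + 2
  · simp only [if_neg e0, if_neg e1, if_pos e2, map_neg, map_mul, FreeAlgebra.lift_ι_apply,
      Module.End.mul_apply, LinearMap.neg_apply, Finsupp.neg_apply]
    rw [two _ _ (by omega) (by omega), h0, h1]
  · simp [if_neg e0, if_neg e1, if_neg e2]

end

/-- if `b₁,…,b_{n-2} ∈ Aₙ` satisfy `Σ_i p̄_{ij} b_i = 0` for every `j`, then
all `b_i` vanish. -/
theorem An_pbar_relations_independent
    (k : Type) [Field k] (n : ℕ) (hn : 3 ≤ n)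
    (b : Fin (n - 2) → AnAlg k n)
    (hb : ∀ j : Fin n, (∑ i, PbarL k n i j * b i) = 0) :
    ∀ i, b i = 0 := by
  intro i
  apply eq_zero_of_wordRep_nil
  ext w
  have h0 : (genIdx n i 0).val = i.val := rfl
  have h1 : (genIdx n i 1).val = i.val + 1 := rfl
  have h2 : (genIdx n i 2).val = i.val + 2 := rfl
  have key (j u v : Fin n) := congrArg
    (fun a => wordRep k n a (Finsupp.single [] 1) (u :: v :: w)) (hb j)
  simp only [map_sum, map_mul, LinearMap.sum_apply, Finsupp.finsetSum_apply,
    Module.End.mul_apply, map_zero, LinearMap.zero_apply, Finsupp.zero_apply] at key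
  have hmod : i.val % 3 = 0 ∨ i.val % 3 = 1 ∨ i.val % 3 = 2 := by omega
  rcases hmod with h | h | h
  · have hk := key (genIdx n i 0) (genIdx n i 2) (genIdx n i 1)
    rw [Finset.sum_eq_single_of_mem i (Finset.mem_univ i), wordRep_PbarL_apply (by omega)] at hk
    · simpa [h0, h1, h2] using hk
    · intro l _ hl
      have hl' := Fin.val_ne_of_ne hl
      rw [wordRep_PbarL_apply (by omega)]
      split_ifs <;> first | omega | simp
  · have hk := key (genIdx n i 2) (genIdx n i 0) (genIdx n i 1)
    rw [Finset.sum_eq_single_of_mem i (Finset.mem_univ i), wordRep_PbarL_apply (by omega)] at hk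
    · simpa [h0, h1, h2] using hk
    · intro l _ hl
      have hl' := Fin.val_ne_of_ne hl
      rw [wordRep_PbarL_apply (by omega)]
      split_ifs <;> first | omega | simp
  · have hk := key (genIdx n i 1) (genIdx n i 2) (genIdx n i 0)
    rw [Finset.sum_eq_single_of_mem i (Finset.mem_univ i), wordRep_PbarL_apply (by omega)] at hk
    · simpa [h0, h1, h2] using hk
    · intro l _ hl
      have hl' := Fin.val_ne_of_ne hl
      rw [wordRep_PbarL_apply (by omega)]
      split_ifs <;> first | omega | simp

end
end
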